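/- arXiv:2111.07633 — 2 statements merged into one kernel-verified Lean document; each statement's English description precedes it below -/
import Mathlib

section
/- Let $W$ be an $N \times N$ nonnegative matrix with $\|W\|_\infty \le 1$ (row sums at most one). Suppose there exists a set $V \subseteq \{1, \dots, N\}$ with $|V| \le K$ such that every column $j \notin V$ has column sum $\sum_{i=1}^N w_{ij} \le 1$, and every column $j \in V$ has column sum at most $\Gamma_u := \|W\|_1$. Then for every positive integer $h$, $\|W^h\|_1 \le h K \Gamma_u$. -/
open Finset

/-- If a nonnegative matrix has row sums at most one, all column sums at most `Γ`,
and all columns outside a set `V` of at most `K` indices have column sums at most one,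
then the maximal column sum of `W^h` is at most `h * K * Γ`. -/
theorem stmt3 (N : ℕ) (W : Matrix (Fin N) (Fin N) ℝ)
    (hnn : ∀ i j, 0 ≤ W i j)
    (hrow : ∀ i, ∑ j, W i j ≤ 1)
    (K : ℕ) (hK : 1 ≤ K) (Γ : ℝ) (hΓ : 1 ≤ Γ)
    (V : Finset (Fin N)) (hV : V.card ≤ K)
    (hcolV : ∀ j, ∑ i, W i j ≤ Γ)
    (hcol : ∀ j ∉ V, ∑ i, W i j ≤ 1) :
    ∀ h : ℕ, 1 ≤ h → ∀ j, ∑ i, (W ^ h) i j ≤ (h : ℝ) * K * Γ := by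
  have key : ∀ n : ℕ, (∀ i j, 0 ≤ (W ^ n) i j) ∧ (∀ i, ∑ j, (W ^ n) i j ≤ 1) := by
    intro n
    induction n with
    | zero =>
      refine ⟨fun i j => ?_, fun i => ?_⟩
      · rw [pow_zero, Matrix.one_apply]
        split_ifs <;> norm_num
      · simp [Matrix.one_apply]
    | succ n ih =>
      obtain ⟨h0, h1⟩ := ih
      refine ⟨fun i j => ?_, fun i => ?_⟩
      · rw [pow_succ', Matrix.mul_apply]
        exact Finset.sum_nonneg fun k _ => mul_nonneg (hnn i k) (h0 k j)
      · simp only [pow_succ', Matrix.mul_apply]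
        rw [Finset.sum_comm]
        refine le_trans (Finset.sum_le_sum fun k _ => ?_) (hrow i)
        rw [← Finset.mul_sum]
        exact mul_le_of_le_one_right (hnn i k) (h1 k)
  have hKr : (1 : ℝ) ≤ K := by exact_mod_cast hK
  have hVr : (V.card : ℝ) ≤ K := by exact_mod_cast hV
  intro h hh
  induction h, hh using Nat.le_induction with
  | base =>
    intro k
    have := hcolV k
    simp only [pow_one, Nat.cast_one, one_mul]
    nlinarith
  | succ n hn ih =>
    intro k
    obtain ⟨h0, h1⟩ := key n
    have hle : ∀ j, (W ^ n) j k ≤ 1 := fun j =>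
      le_trans (Finset.single_le_sum (f := fun k => (W ^ n) j k)
        (fun l _ => h0 j l) (Finset.mem_univ k)) (h1 j)
    have hstep : ∑ i, (W ^ (n + 1)) i k
        ≤ ∑ j, ((if j ∈ V then Γ else 0) + (W ^ n) j k) := by
      simp only [pow_succ', Matrix.mul_apply]
      rw [Finset.sum_comm]
      refine Finset.sum_le_sum fun j _ => ?_
      rw [← Finset.sum_mul]
      have a := h0 j k
      have b := hle j
      split_ifs with hj
      · have c := hcolV j
        nlinarith [mul_le_mul_of_nonneg_right c a]
      · have c := hcol j hj
        nlinarith [mul_le_mul_of_nonneg_right c a]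
    have hsum : ∑ j, ((if j ∈ V then Γ else 0) + (W ^ n) j k)
        = V.card * Γ + ∑ j, (W ^ n) j k := by
      rw [Finset.sum_add_distrib]
      simp
    have hi := ih k
    have hm : (V.card : ℝ) * Γ ≤ K * Γ := mul_le_mul_of_nonneg_right hVr (by linarith)
    push_cast
    rw [hsum] at hstep
    linarith
end

section
/- Let $X \in L^p(\mathscr{F}_1)$ and $Y \in L^q(\mathscr{F}_2)$ for sub-$\sigma$-algebras $\mathscr{F}_1, \mathscr{F}_2$ and exponents $1 \le p, q, r < \infty$ with $1/p + 1/q + 1/r = 1$, and suppose $|X| \le M_X$ and $|Y| \le M_Y$ almost surely for constants $M_X, M_Y$. Then $|\mathrm{Cov}(X, Y)| \le 4\, \alpha(\mathscr{F}_1, \mathscr{F}_2)^{1/r} \, \|X\|_p \, \|Y\|_q$, where $\alpha(\mathscr{F}_1, \mathscr{F}_2) = \sup\{|\mathbb{P}(A \cap B) - \mathbb{P}(A)\mathbb{P}(B)| : A \in \mathscr{F}_1, B \in \mathscr{F}_2\}$ is the strong mixing coefficient. -/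
open MeasureTheory

noncomputable def dvF (u x : ℝ) : ℝ := (if u < x then 1 else 0) - (if u < -x then 1 else 0)

lemma dv_int1 (M x : ℝ) (hM : 0 ≤ M) (hx : x ≤ M) :
    ∫ u in Set.Ioc 0 M, (if u < x then (1:ℝ) else 0) = max x 0 := by
  have h : (fun u : ℝ => if u < x then (1:ℝ) else 0) = Set.indicator (Set.Iio x) (fun _ => 1) := by
    ext u; simp [Set.indicator]
  rw [h, setIntegral_indicator measurableSet_Iio]
  have h2 : (Set.Ioc 0 M ∩ Set.Iio x) = Set.Ioo 0 x := by
    ext u; simp only [Set.mem_inter_iff, Set.mem_Ioc, Set.mem_Iio, Set.mem_Ioo]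
    constructor
    · rintro ⟨⟨a, b⟩, c⟩; exact ⟨a, c⟩
    · rintro ⟨a, c⟩; exact ⟨⟨a, by linarith⟩, c⟩
  rw [h2]; simp [Measure.real, ENNReal.toReal_ofReal']

lemma dvF_meas : Measurable (fun z : ℝ × ℝ => dvF z.1 z.2) := by
  unfold dvF
  refine Measurable.sub ?_ ?_
  · exact Measurable.ite (measurableSet_lt measurable_fst measurable_snd) measurable_const measurable_const
  · exact Measurable.ite (measurableSet_lt measurable_fst measurable_snd.neg) measurable_const measurable_const

lemma dvF_abs (u x : ℝ) : |dvF u x| ≤ 1 := by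
  unfold dvF; split_ifs <;> norm_num

lemma dvF_abs' (u x : ℝ) (hu : 0 < u) : |dvF u x| ≤ if u < |x| then 1 else 0 := by
  unfold dvF
  simp only [lt_abs]
  split_ifs <;> simp_all 

lemma dv_int (M x : ℝ) (hx : |x| ≤ M) : ∫ u in Set.Ioc 0 M, dvF u x = x := by
  have hM : 0 ≤ M := (abs_nonneg x).trans hx
  unfold dvF
  have hi : ∀ y : ℝ, IntegrableOn (fun u : ℝ => if u < y then (1:ℝ) else 0) (Set.Ioc 0 M) := by
    intro y
    refine Integrable.of_bound (C := 1) (Measurable.ite measurableSet_Iio measurable_const measurable_const).aestronglyMeasurable ?_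
    refine Filter.Eventually.of_forall fun u => ?_
    split_ifs <;> norm_num
  rw [integral_sub (hi x) (hi (-x)), dv_int1 M x hM (abs_le.1 hx).2, dv_int1 M (-x) hM (by linarith [(abs_le.1 hx).1])]
  rcases le_total 0 x with h | h
  · rw [max_eq_left h, max_eq_right (by linarith)]; ring
  · rw [max_eq_right h, max_eq_left (by linarith)]; ring

lemma dv_rep {Ω : Type*} {m0 : MeasurableSpace Ω} (μ : Measure Ω) [IsProbabilityMeasure μ]
    (X Z : Ω → ℝ) (hX : Measurable X) (M : ℝ) (hM : ∀ᵐ ω ∂μ, |X ω| ≤ M) (hZ : Integrable Z μ) :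
    ∫ ω, X ω * Z ω ∂μ = ∫ u in Set.Ioc 0 M, ∫ ω, dvF u (X ω) * Z ω ∂μ := by
  rw [integral_integral_swap]
  · refine integral_congr_ae ?_
    filter_upwards [hM] with ω h
    rw [integral_mul_const, dv_int M _ h]
  · refine Integrable.bdd_mul (c := 1) (hZ.comp_snd _) ?_ ?_
    · exact (dvF_meas.comp (measurable_fst.prodMk (hX.comp measurable_snd))).aestronglyMeasurable
    · exact Filter.Eventually.of_forall fun z => dvF_abs _ _

/-- quantile-type function -/
noncomputable def dvQ (G : ℝ → ℝ) (M : ℝ) (s : ℝ) : ℝ := (volume.restrict (Set.Ioc 0 M)).real {u | s < G u}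

lemma dvQ_anti (G : ℝ → ℝ) (M : ℝ) : Antitone (dvQ G M) := by
  intro s t h
  exact measureReal_mono (fun u hu => lt_of_le_of_lt h hu)

lemma dvQ_lt (G : ℝ → ℝ) (hG : Antitone G) (M s t : ℝ) (ht : 0 ≤ t) (h : t < dvQ G M s) : s < G t := by
  by_contra hc
  push Not at hc
  apply absurd h
  push Not
  have h1 : {u | s < G u} ⊆ Set.Iio t := by
    intro u hu
    by_contra h'
    simp only [Set.mem_Iio, not_lt] at h'
    exact absurd (hG h') (by have : s < G u := hu; linarith)
  unfold dvQ Measure.real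
  refine ENNReal.toReal_le_of_le_ofReal ht ?_
  calc _ ≤ (volume.restrict (Set.Ioc 0 M)) (Set.Iio t) := measure_mono h1
    _ ≤ volume (Set.Ioo 0 t) := by
      rw [Measure.restrict_apply measurableSet_Iio]
      exact measure_mono (fun u hu => ⟨hu.2.1, hu.1⟩)
    _ = _ := by simp

lemma dvQ_Lp {Ω : Type*} {m0 : MeasurableSpace Ω} (μ : Measure Ω) [IsProbabilityMeasure μ]
    (X : Ω → ℝ) (hX : Measurable X) (M p : ℝ) (hp : 1 ≤ p) :
    ∫⁻ s in Set.Ioi 0, ENNReal.ofReal (dvQ (fun u => μ.real {ω | u < |X ω|}) M s ^ p)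
      ≤ ∫⁻ ω, ENNReal.ofReal (|X ω| ^ p) ∂μ := by
  have hG : Antitone (fun u => μ.real {ω | u < |X ω|}) := 
    fun u v h => measureReal_mono (fun ω hω => lt_of_le_of_lt h hω)
  rw [lintegral_rpow_eq_lintegral_meas_lt_mul μ (Filter.Eventually.of_forall fun ω => abs_nonneg _) 
    hX.abs.aemeasurable (by linarith),
    lintegral_rpow_eq_lintegral_meas_lt_mul (f := dvQ (fun u => μ.real {ω | u < |X ω|}) M) _ (Filter.Eventually.of_forall fun ω => measureReal_nonneg) 
    (dvQ_anti _ _).measurable.aemeasurable (by linarith)]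
  gcongr 1
  refine setLIntegral_mono' measurableSet_Ioi fun t ht => ?_
  gcongr 1
  calc _ ≤ (volume.restrict (Set.Ioi 0)) (Set.Iio (μ.real {ω | t < |X ω|})) := 
        measure_mono fun s hs => dvQ_lt _ hG M s t (le_of_lt ht) hs
    _ = volume (Set.Ioo 0 (μ.real {ω | t < |X ω|})) := by
      rw [Measure.restrict_apply measurableSet_Iio, Set.inter_comm, Set.Ioi_inter_Iio]
    _ = _ := by simp

lemma dv_cov_ind {Ω : Type*} {m0 : MeasurableSpace Ω} (μ : Measure Ω)
    [IsProbabilityMeasure μ]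
    (m₁ m₂ : MeasurableSpace Ω) (hm₁ : m₁ ≤ m0) (hm₂ : m₂ ≤ m0)
    (X Y : Ω → ℝ) (hX : Measurable[m₁] X) (hY : Measurable[m₂] Y)
    (a : ℝ)
    (hmix : ∀ A B : Set Ω, MeasurableSet[m₁] A → MeasurableSet[m₂] B →
      |(μ (A ∩ B)).toReal - (μ A).toReal * (μ B).toReal| ≤ a) (u v : ℝ) :
    |(∫ ω, dvF u (X ω) * dvF v (Y ω) ∂μ) - (∫ ω, dvF u (X ω) ∂μ) * ∫ ω, dvF v (Y ω) ∂μ| ≤ 4 * a := by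
  have hA : MeasurableSet[m₁] {ω | u < X ω} := hX measurableSet_Ioi
  have hA' : MeasurableSet[m₁] {ω | u < -X ω} := hX.neg measurableSet_Ioi
  have hB : MeasurableSet[m₂] {ω | v < Y ω} := hY measurableSet_Ioi
  have hB' : MeasurableSet[m₂] {ω | v < -Y ω} := hY.neg measurableSet_Ioi
  have e : ∀ (u : ℝ) (X : Ω → ℝ), (fun ω => dvF u (X ω)) = fun ω => {ω | u < X ω}.indicator (1 : Ω → ℝ) ω - {ω | u < -X ω}.indicator (1 : Ω → ℝ) ω := by
    intro u X; ext ω; simp [dvF, Set.indicator]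
  have e1 := congrFun (e u X)
  have e2 := congrFun (e v Y)
  simp only [e1, e2]
  have m1 := hmix _ _ hA hB
  have m2 := hmix _ _ hA hB'
  have m3 := hmix _ _ hA' hB
  have m4 := hmix _ _ hA' hB'
  generalize {ω | u < X ω} = A at *
  generalize {ω | u < -X ω} = A' at *
  generalize {ω | v < Y ω} = B at *
  generalize {ω | v < -Y ω} = B' at *
  replace hA := hm₁ _ hA
  replace hA' := hm₁ _ hA'
  replace hB := hm₂ _ hB
  replace hB' := hm₂ _ hB'
  have hi : ∀ {S : Set Ω}, MeasurableSet[m0] S → Integrable (fun ω => S.indicator (1 : Ω → ℝ) ω) μ := 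
    fun h => (integrable_const (1:ℝ)).indicator h
  have hv : ∀ {S : Set Ω}, MeasurableSet[m0] S → ∫ ω, S.indicator (1 : Ω → ℝ) ω ∂μ = (μ S).toReal := by
    intro S h
    rw [integral_indicator_one h]; rfl
  have ep : (fun ω => (A.indicator (1 : Ω → ℝ) ω - A'.indicator (1 : Ω → ℝ) ω) * (B.indicator (1 : Ω → ℝ) ω - B'.indicator (1 : Ω → ℝ) ω)) = 
    fun ω => ((A ∩ B).indicator (1 : Ω → ℝ) ω - (A ∩ B').indicator (1 : Ω → ℝ) ω) - ((A' ∩ B).indicator (1 : Ω → ℝ) ω - (A' ∩ B').indicator (1 : Ω → ℝ) ω) := by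
    ext ω
    simp only [Set.inter_indicator_one, Pi.mul_apply]; ring
  have hd : ∀ {S T : Set Ω}, MeasurableSet[m0] S → MeasurableSet[m0] T →
      Integrable (fun ω => S.indicator (1 : Ω → ℝ) ω - T.indicator (1 : Ω → ℝ) ω) μ :=
    fun h h' => (hi h).sub (hi h')
  rw [ep, integral_sub (hd (hA.inter hB) (hA.inter hB')) (hd (hA'.inter hB) (hA'.inter hB')),
    integral_sub (hi (hA.inter hB)) (hi (hA.inter hB')), integral_sub (hi (hA'.inter hB)) (hi (hA'.inter hB')),
    integral_sub (hi hA) (hi hA'), integral_sub (hi hB) (hi hB'), hv hA, hv hA', hv hB, hv hB', 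
    hv (hA.inter hB), hv (hA.inter hB'), hv (hA'.inter hB), hv (hA'.inter hB')]
  rw [abs_le] at *
  constructor <;> nlinarith

lemma dv_cov_tail {Ω : Type*} {m0 : MeasurableSpace Ω} (μ : Measure Ω)
    [IsProbabilityMeasure μ] (X g : Ω → ℝ) (hX : Measurable X) (hg : Measurable g) (hg1 : ∀ ω, |g ω| ≤ 1)
    (u : ℝ) (hu : 0 < u) :
    |(∫ ω, dvF u (X ω) * g ω ∂μ) - (∫ ω, dvF u (X ω) ∂μ) * ∫ ω, g ω ∂μ| ≤ 2 * μ.real {ω | u < |X ω|} := by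
  have hS : MeasurableSet {ω | u < |X ω|} := hX.abs measurableSet_Ioi
  have hv : ∫ ω, (if u < |X ω| then (1:ℝ) else 0) ∂μ = μ.real {ω | u < |X ω|} := by
    rw [← integral_indicator_one hS]; congr 1
  have hi : Integrable (fun ω => if u < |X ω| then (1:ℝ) else 0) μ := 
    (integrable_const (1:ℝ)).indicator hS
  have h1 : |∫ ω, dvF u (X ω) * g ω ∂μ| ≤ μ.real {ω | u < |X ω|} := by
    rw [← hv]
    refine norm_integral_le_of_norm_le (f := fun ω => dvF u (X ω) * g ω) hi (Filter.Eventually.of_forall fun ω => ?_)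
    rw [Real.norm_eq_abs, abs_mul]
    exact (mul_le_of_le_one_right (abs_nonneg _) (hg1 ω)).trans (dvF_abs' _ _ hu)
  have h2 : |∫ ω, dvF u (X ω) ∂μ| ≤ μ.real {ω | u < |X ω|} := by
    rw [← hv]
    exact norm_integral_le_of_norm_le (f := fun ω => dvF u (X ω)) hi (Filter.Eventually.of_forall fun ω => dvF_abs' _ _ hu)
  have h3 : |∫ ω, g ω ∂μ| ≤ 1 := by
    simpa using norm_integral_le_of_norm_le_const (μ := μ) (f := g) (C := 1) (Filter.Eventually.of_forall hg1)
  calc _ ≤ |∫ ω, dvF u (X ω) * g ω ∂μ| + |(∫ ω, dvF u (X ω) ∂μ) * ∫ ω, g ω ∂μ| := abs_sub _ _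
    _ ≤ _ := by
      rw [abs_mul]
      have := mul_le_of_le_one_right (abs_nonneg (∫ ω, dvF u (X ω) ∂μ)) h3
      linarith

/-- Double-integral bound via quantile functions -/
lemma dv_tonelli (G H : ℝ → ℝ) (hG : Antitone G) (hH : Antitone H) (M N c : ℝ) :
    ∫⁻ u in Set.Ioc 0 M, ∫⁻ v in Set.Ioc 0 N, ENNReal.ofReal (min c (min (G u) (H v))) =
    ∫⁻ s in Set.Ioi 0, (Set.Iio c).indicator 1 s * (ENNReal.ofReal (dvQ G M s) * ENNReal.ofReal (dvQ H N s)) := by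
  have hq : ∀ (G : ℝ → ℝ) (hG : Antitone G) (M s : ℝ), ENNReal.ofReal (dvQ G M s) = ∫⁻ u in Set.Ioc 0 M, {u | s < G u}.indicator 1 u := by
    intro G hG M s
    rw [lintegral_indicator_one (measurableSet_lt measurable_const hG.measurable)]
    unfold dvQ; exact ofReal_measureReal
  have hm : ∀ u v, ENNReal.ofReal (min c (min (G u) (H v))) = ∫⁻ s in Set.Ioi 0, (Set.Iio c).indicator 1 s * ((Set.Iio (G u)).indicator 1 s * (Set.Iio (H v)).indicator 1 s) := by
    intro u v
    have : ∀ s, (Set.Iio c).indicator (1 : ℝ → ENNReal) s * ((Set.Iio (G u)).indicator 1 s * (Set.Iio (H v)).indicator 1 s) = (Set.Iio (min c (min (G u) (H v)))).indicator 1 s := by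
      intro s
      simp only [← Set.Iio_inter_Iio, Set.inter_indicator_one, Pi.mul_apply]
    simp only [this]
    rw [lintegral_indicator_one measurableSet_Iio, Measure.restrict_apply measurableSet_Iio, Set.inter_comm, Set.Ioi_inter_Iio]
    simp
  have mG : Measurable (fun z : ℝ × ℝ => (Set.Iio (G z.1)).indicator (1 : ℝ → ENNReal) z.2) := by
    have : (fun z : ℝ × ℝ => (Set.Iio (G z.1)).indicator (1 : ℝ → ENNReal) z.2) = {z : ℝ × ℝ | z.2 < G z.1}.indicator 1 := by
      ext z; simp [Set.indicator]
    rw [this]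
    exact measurable_one.indicator (measurableSet_lt measurable_snd (hG.measurable.comp measurable_fst))
  have mH : Measurable (fun z : ℝ × ℝ => (Set.Iio (H z.1)).indicator (1 : ℝ → ENNReal) z.2) := by
    have : (fun z : ℝ × ℝ => (Set.Iio (H z.1)).indicator (1 : ℝ → ENNReal) z.2) = {z : ℝ × ℝ | z.2 < H z.1}.indicator 1 := by
      ext z; simp [Set.indicator]
    rw [this]
    exact measurable_one.indicator (measurableSet_lt measurable_snd (hH.measurable.comp measurable_fst))
  have mc : Measurable ((Set.Iio c).indicator (1 : ℝ → ENNReal)) := measurable_one.indicator measurableSet_Iio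
  have mQ : Measurable fun s => ENNReal.ofReal (dvQ H N s) := (dvQ_anti H N).measurable.ennreal_ofReal
  simp only [hm]
  have inner : ∀ u, ∫⁻ v in Set.Ioc 0 N, ∫⁻ s in Set.Ioi 0, (Set.Iio c).indicator 1 s * ((Set.Iio (G u)).indicator 1 s * (Set.Iio (H v)).indicator 1 s)
      = ∫⁻ s in Set.Ioi 0, (Set.Iio c).indicator 1 s * ((Set.Iio (G u)).indicator 1 s * ENNReal.ofReal (dvQ H N s)) := by
    intro u
    have mGu : Measurable ((Set.Iio (G u)).indicator (1 : ℝ → ENNReal)) := measurable_one.indicator measurableSet_Iio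
    rw [lintegral_lintegral_swap]
    · refine lintegral_congr fun s => ?_
      have mHs : Measurable (fun v => (Set.Iio (H v)).indicator (1 : ℝ → ENNReal) s) := mH.comp (measurable_id.prodMk measurable_const)
      rw [lintegral_const_mul _ (mHs.const_mul _), lintegral_const_mul _ mHs, hq H hH]
      rfl
    · exact ((mc.comp measurable_snd).mul ((mGu.comp measurable_snd).mul mH)).aemeasurable
  simp only [inner]
  rw [lintegral_lintegral_swap]
  · refine lintegral_congr fun s => ?_
    have mGs : Measurable (fun v => (Set.Iio (G v)).indicator (1 : ℝ → ENNReal) s) := mG.comp (measurable_id.prodMk measurable_const)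
    rw [lintegral_const_mul _ (mGs.mul_const _), lintegral_mul_const _ mGs, hq G hG]
    rfl
  · exact ((mc.comp measurable_snd).mul (mG.mul (mQ.comp measurable_snd))).aemeasurable

lemma dv_holder (f g h : ℝ → ENNReal) (hf : Measurable f) (hg : Measurable g) (hh : Measurable h) (ν : Measure ℝ)
    (p q r : ℝ) (hp : 1 ≤ p) (hq : 1 ≤ q) (hr : 1 ≤ r)
    (hpqr : 1 / p + 1 / q + 1 / r = 1) :
    ∫⁻ s, h s * (f s * g s) ∂ν ≤ (∫⁻ s, h s ^ r ∂ν) ^ (1/r) * ((∫⁻ s, f s ^ p ∂ν) ^ (1/p) * (∫⁻ s, g s ^ q ∂ν) ^ (1/q)) := by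
  have := ENNReal.lintegral_prod_norm_pow_le (μ := ν) (Finset.univ : Finset (Fin 3)) (f := ![fun s => h s ^ r, fun s => f s ^ p, fun s => g s ^ q])
    (p := ![1/r, 1/p, 1/q]) (by intro i _; fin_cases i <;> simp <;> fun_prop) (by simp [Fin.sum_univ_three] at *; linarith)
    (by intro i _; fin_cases i <;> simp <;> linarith)
  simp only [Fin.prod_univ_three] at this
  have e : ∀ (x : ENNReal) (p : ℝ), 1 ≤ p → (x ^ p) ^ (1/p) = x := by
    intro x p hp
    rw [← ENNReal.rpow_mul, mul_one_div_cancel (by linarith), ENNReal.rpow_one]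
  simp [-one_div] at this
  simp only [e _ _ hp, e _ _ hq, e _ _ hr] at this
  simpa only [mul_assoc] using this

lemma dv_core {Ω : Type*} {m0 : MeasurableSpace Ω} (μ : Measure Ω)
    [IsProbabilityMeasure μ]
    (X Y : Ω → ℝ) (hX0 : Measurable X) (hY0 : Measurable Y)
    (p q r : ℝ) (hp : 1 ≤ p) (hq : 1 ≤ q) (hr : 1 ≤ r)
    (hpqr : 1 / p + 1 / q + 1 / r = 1)
    (MX MY : ℝ) (hMX : ∀ᵐ ω ∂μ, |X ω| ≤ MX) (hMY : ∀ᵐ ω ∂μ, |Y ω| ≤ MY)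
    (a : ℝ) (ha : 0 ≤ a)
    (hind : ∀ u v, |(∫ ω, dvF u (X ω) * dvF v (Y ω) ∂μ) - (∫ ω, dvF u (X ω) ∂μ) * ∫ ω, dvF v (Y ω) ∂μ| ≤ 4 * a) :
    |(∫ ω, X ω * Y ω ∂μ) - (∫ ω, X ω ∂μ) * ∫ ω, Y ω ∂μ| ≤
      4 * a ^ (1 / r) * (∫ ω, |X ω| ^ p ∂μ) ^ (1 / p) *
        (∫ ω, |Y ω| ^ q ∂μ) ^ (1 / q) := by
  have iX : Integrable X μ := Integrable.of_bound hX0.aestronglyMeasurable MX hMX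
  have iY : Integrable Y μ := Integrable.of_bound hY0.aestronglyMeasurable MY hMY
  have iXY : Integrable (fun ω => X ω * Y ω) μ := iY.bdd_mul hX0.aestronglyMeasurable hMX
  have mF : ∀ (X : Ω → ℝ) (hX : Measurable X) (u : ℝ), Measurable (fun ω => dvF u (X ω)) := fun X hX u =>
    dvF_meas.comp (measurable_const.prodMk hX)
  have iF : ∀ (X : Ω → ℝ) (hX : Measurable X) (u : ℝ), Integrable (fun ω => dvF u (X ω)) μ := fun X hX u =>
    Integrable.of_bound (mF X hX u).aestronglyMeasurable 1 (Filter.Eventually.of_forall fun ω => dvF_abs _ _)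
  have key : (∫ ω, X ω * Y ω ∂μ) - (∫ ω, X ω ∂μ) * ∫ ω, Y ω ∂μ = 
      ∫ u in Set.Ioc 0 MX, ∫ v in Set.Ioc 0 MY, 
       ((∫ ω, dvF u (X ω) * dvF v (Y ω) ∂μ) - (∫ ω, dvF u (X ω) ∂μ) * ∫ ω, dvF v (Y ω) ∂μ) := by
    have h1 : (∫ ω, X ω * Y ω ∂μ) - (∫ ω, X ω ∂μ) * ∫ ω, Y ω ∂μ = ∫ ω, X ω * (Y ω - ∫ ω, Y ω ∂μ) ∂μ := by
      simp only [mul_sub]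
      rw [integral_sub iXY (iX.mul_const _), integral_mul_const]
    rw [h1, dv_rep μ X (fun ω => Y ω - ∫ ω, Y ω ∂μ) hX0 MX hMX (iY.sub (integrable_const _))]
    congr 1
    ext u
    have i1 : Integrable (fun ω => dvF u (X ω) * Y ω) μ := 
      iY.bdd_mul (c := 1) (mF X hX0 u).aestronglyMeasurable (Filter.Eventually.of_forall fun ω => dvF_abs _ _)
    have h2 : ∫ ω, dvF u (X ω) * (Y ω - ∫ ω, Y ω ∂μ) ∂μ = ∫ ω, Y ω * (dvF u (X ω) - ∫ ω, dvF u (X ω) ∂μ) ∂μ := by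
      simp only [mul_sub]
      rw [integral_sub i1 ((iF X hX0 u).mul_const _), integral_sub (by simpa only [mul_comm] using i1) (iY.mul_const _), integral_mul_const, integral_mul_const]
      simp only [mul_comm]
    rw [h2, dv_rep μ Y (fun ω => dvF u (X ω) - ∫ ω, dvF u (X ω) ∂μ) hY0 MY hMY ((iF X hX0 u).sub (integrable_const _))]
    congr 1
    ext v
    have i2 : Integrable (fun ω => dvF v (Y ω) * dvF u (X ω)) μ := 
      (iF X hX0 u).bdd_mul (c := 1) (mF Y hY0 v).aestronglyMeasurable (Filter.Eventually.of_forall fun ω => dvF_abs _ _)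
    simp only [mul_sub]
    rw [integral_sub i2 ((iF Y hY0 v).mul_const _), integral_mul_const]
    simp only [mul_comm]
  set G := fun u => μ.real {ω | u < |X ω|} with hGd
  set H := fun u => μ.real {ω | u < |Y ω|} with hHd
  have hG : Antitone G := 
    fun u v h => measureReal_mono (fun ω hω => lt_of_le_of_lt h hω)
  have hH : Antitone H := 
    fun u v h => measureReal_mono (fun ω hω => lt_of_le_of_lt h hω)
  have kb : ∀ u v, 0 < u → 0 < v → |(∫ ω, dvF u (X ω) * dvF v (Y ω) ∂μ) - (∫ ω, dvF u (X ω) ∂μ) * ∫ ω, dvF v (Y ω) ∂μ|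
      ≤ 2 * min (2 * a) (min (G u) (H v)) := by
    intro u v hu hv
    rw [mul_min_of_nonneg _ _ zero_le_two, mul_min_of_nonneg _ _ zero_le_two]
    refine le_min ?_ (le_min ?_ ?_)
    · linarith [hind u v]
    · exact dv_cov_tail μ X _ hX0 (mF Y hY0 v) (fun ω => dvF_abs _ _) u hu
    · have := dv_cov_tail μ Y _ hY0 (mF X hX0 u) (fun ω => dvF_abs _ _) v hv
      rw [mul_comm (∫ ω, dvF v (Y ω) ∂μ)] at this
      simpa only [mul_comm (dvF v _)] using this
  have iP : ∀ (X : Ω → ℝ) (hX : Measurable X) (M : ℝ) (hM : ∀ᵐ ω ∂μ, |X ω| ≤ M) (p : ℝ), 1 ≤ p → 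
      (∫⁻ s in Set.Ioi 0, ENNReal.ofReal (dvQ (fun u => μ.real {ω | u < |X ω|}) M s) ^ p) ^ (1/p) ≤ ENNReal.ofReal ((∫ ω, |X ω| ^ p ∂μ) ^ (1/p)) := by
    intro X hX M hM p hp
    have i : Integrable (fun ω => |X ω| ^ p) μ := by
      refine Integrable.of_bound (hX.abs.pow_const p).aestronglyMeasurable (M ^ p) ?_
      filter_upwards [hM] with ω h
      rw [Real.norm_eq_abs, abs_of_nonneg (by positivity)]
      exact Real.rpow_le_rpow (abs_nonneg _) h (by linarith)
    rw [← ENNReal.ofReal_rpow_of_nonneg (integral_nonneg fun ω => by positivity) (by positivity)]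
    refine ENNReal.rpow_le_rpow ?_ (by positivity)
    rw [ofReal_integral_eq_lintegral_ofReal i (Filter.Eventually.of_forall fun ω => by positivity)]
    refine le_trans (le_of_eq ?_) (dvQ_Lp μ X hX M p hp)
    refine lintegral_congr fun s => ?_
    exact ENNReal.ofReal_rpow_of_nonneg measureReal_nonneg (by linarith)
  have hc : (∫⁻ s in Set.Ioi 0, (Set.Iio (2 * a)).indicator (1 : ℝ → ENNReal) s ^ r) ^ (1/r) = ENNReal.ofReal ((2 * a) ^ (1/r)) := by
    have : ∀ s, (Set.Iio (2 * a)).indicator (1 : ℝ → ENNReal) s ^ r = (Set.Iio (2 * a)).indicator (1 : ℝ → ENNReal) s := by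
      intro s
      simp only [Set.indicator]
      split_ifs
      · simp
      · simp; linarith
    simp only [this]
    rw [lintegral_indicator_one measurableSet_Iio, Measure.restrict_apply measurableSet_Iio, Set.inter_comm, Set.Ioi_inter_Iio,
      Real.volume_Ioo, sub_zero, ENNReal.ofReal_rpow_of_nonneg (by positivity) (by positivity)]
  have main : ENNReal.ofReal |(∫ ω, X ω * Y ω ∂μ) - (∫ ω, X ω ∂μ) * ∫ ω, Y ω ∂μ| ≤ 
      ENNReal.ofReal (2 * ((2 * a) ^ (1/r) * ((∫ ω, |X ω| ^ p ∂μ) ^ (1 / p) * (∫ ω, |Y ω| ^ q ∂μ) ^ (1 / q)))) := by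
    rw [key, ← Real.enorm_eq_ofReal_abs]
    calc _ ≤ ∫⁻ u in Set.Ioc 0 MX, ∫⁻ v in Set.Ioc 0 MY, 
         2 * ENNReal.ofReal (min (2 * a) (min (G u) (H v))) := by
          refine (enorm_integral_le_lintegral_enorm _).trans (setLIntegral_mono' measurableSet_Ioc fun u hu => ?_)
          refine (enorm_integral_le_lintegral_enorm _).trans (setLIntegral_mono' measurableSet_Ioc fun v hv => ?_)
          rw [Real.enorm_eq_ofReal_abs]
          refine (ENNReal.ofReal_le_ofReal (kb u v hu.1 hv.1)).trans (le_of_eq ?_)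
          rw [ENNReal.ofReal_mul zero_le_two]; simp
      _ = 2 * ∫⁻ u in Set.Ioc 0 MX, ∫⁻ v in Set.Ioc 0 MY, 
          ENNReal.ofReal (min (2 * a) (min (G u) (H v))) := by
          simp only [lintegral_const_mul' 2 _ (by simp : (2:ENNReal) ≠ ⊤)]
      _ ≤ 2 * (ENNReal.ofReal ((2 * a) ^ (1/r)) * (ENNReal.ofReal ((∫ ω, |X ω| ^ p ∂μ) ^ (1 / p)) * ENNReal.ofReal ((∫ ω, |Y ω| ^ q ∂μ) ^ (1 / q)))) := by
          rw [dv_tonelli G H hG hH]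
          gcongr
          refine (dv_holder _ _ _ (dvQ_anti _ _).measurable.ennreal_ofReal (dvQ_anti _ _).measurable.ennreal_ofReal (measurable_one.indicator measurableSet_Iio) _ p q r hp hq hr hpqr).trans ?_
          rw [hc]
          gcongr
          · exact iP X hX0 MX hMX p hp
          · exact iP Y hY0 MY hMY q hq
      _ = _ := by
          rw [ENNReal.ofReal_mul zero_le_two, ENNReal.ofReal_mul (by positivity), ENNReal.ofReal_mul (Real.rpow_nonneg (integral_nonneg fun ω => by positivity) _)]
          simp
  have nX : 0 ≤ (∫ ω, |X ω| ^ p ∂μ) ^ (1 / p) := Real.rpow_nonneg (integral_nonneg fun ω => by positivity) _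
  have nY : 0 ≤ (∫ ω, |Y ω| ^ q ∂μ) ^ (1 / q) := Real.rpow_nonneg (integral_nonneg fun ω => by positivity) _
  rw [ENNReal.ofReal_le_ofReal_iff (by positivity)] at main
  refine main.trans ?_
  rw [Real.mul_rpow zero_le_two ha]
  have h2 : (2:ℝ) ^ (1/r) ≤ 2 := by
    calc (2:ℝ) ^ (1/r) ≤ 2 ^ (1:ℝ) := Real.rpow_le_rpow_of_exponent_le one_le_two (by rw [div_le_one (by linarith)]; exact hr)
      _ = 2 := by simp
  have n3 : 0 ≤ a ^ (1/r) * ((∫ ω, |X ω| ^ p ∂μ) ^ (1 / p) * (∫ ω, |Y ω| ^ q ∂μ) ^ (1 / q)) := by positivity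
  nlinarith [mul_le_mul_of_nonneg_right h2 n3]

/-- Davydov/Ibragimov covariance inequality for strongly mixing σ-algebras:
`|Cov(X,Y)| ≤ 4 α^{1/r} ‖X‖_p ‖Y‖_q` whenever `1/p + 1/q + 1/r = 1`. -/
theorem stmt19 {Ω : Type*} {m0 : MeasurableSpace Ω} (μ : Measure Ω)
    [IsProbabilityMeasure μ]
    (m₁ m₂ : MeasurableSpace Ω) (hm₁ : m₁ ≤ m0) (hm₂ : m₂ ≤ m0)
    (X Y : Ω → ℝ) (hX : Measurable[m₁] X) (hY : Measurable[m₂] Y)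
    (p q r : ℝ) (hp : 1 ≤ p) (hq : 1 ≤ q) (hr : 1 ≤ r)
    (hpqr : 1 / p + 1 / q + 1 / r = 1)
    (MX MY : ℝ) (hMX : ∀ᵐ ω ∂μ, |X ω| ≤ MX) (hMY : ∀ᵐ ω ∂μ, |Y ω| ≤ MY)
    (a : ℝ) (ha : 0 ≤ a)
    (hmix : ∀ A B : Set Ω, MeasurableSet[m₁] A → MeasurableSet[m₂] B →
      |(μ (A ∩ B)).toReal - (μ A).toReal * (μ B).toReal| ≤ a) :
    |(∫ ω, X ω * Y ω ∂μ) - (∫ ω, X ω ∂μ) * ∫ ω, Y ω ∂μ| ≤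
      4 * a ^ (1 / r) * (∫ ω, |X ω| ^ p ∂μ) ^ (1 / p) *
        (∫ ω, |Y ω| ^ q ∂μ) ^ (1 / q) := by
  exact dv_core μ X Y (hX.mono hm₁ le_rfl) (hY.mono hm₂ le_rfl) p q r hp hq hr hpqr MX MY hMX hMY a ha
    (dv_cov_ind μ m₁ m₂ hm₁ hm₂ X Y hX hY a hmix)
end
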